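/- Suppose (A_t), 0 ≤ t ≤ 1, is a continuous path of positive n×n real matrices such that every A_t is conjugate over ℝ to A₀ (i.e., A_t = G⁻¹A₀G for some G ∈ GL(n,ℝ)). Then A₀ and A₁ are strong shift equivalent over ℝ₊ through positive matrices of size n. -/

import Mathlib

open Matrix

/-- A matrix is positive if every entry is positive. -/
def PosEntries {m n : ℕ} (A : Matrix (Fin m) (Fin n) ℝ) : Prop :=
  ∀ i j, 0 < A i j

open scoped Topology

/-- The matrix inverse is continuous at invertible real matrices. -/
lemma continuousAt_inv_of_det_ne_zero {n : ℕ} {Z : Matrix (Fin n) (Fin n) ℝ} (hZ : Z.det ≠ 0) :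
    ContinuousAt (fun Y : Matrix (Fin n) (Fin n) ℝ => Y⁻¹) Z :=
  continuousAt_matrix_inv Z (by simpa only [Ring.inverse_eq_inv'] using continuousAt_inv₀ hZ)

lemma isOpen_setOf_posEntries {m n : ℕ} :
    IsOpen {M : Matrix (Fin m) (Fin n) ℝ | PosEntries M} := by
  simp only [PosEntries, Set.ofPred_forall]
  exact isOpen_iInter_of_finite fun i => isOpen_iInter_of_finite fun j =>
    isOpen_lt continuous_const (continuous_id.matrix_elem i j)

/-- Matrices conjugate to `A` and close to `A` are conjugate to `A` by an intertwiner close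
to the identity. -/
lemma eventually_exists_intertwiner {n : ℕ} (A : Matrix (Fin n) (Fin n) ℝ)
    {U : Set (Matrix (Fin n) (Fin n) ℝ)} (hU : U ∈ 𝓝 1) :
    ∀ᶠ B in 𝓝 A, (∃ G H : Matrix (Fin n) (Fin n) ℝ, G * H = 1 ∧ H * G = 1 ∧ B = H * A * G) →
      ∃ X ∈ U, A * X = X * B := by
  let _ : NormedRing (Matrix (Fin n) (Fin n) ℝ) := Matrix.linftyOpNormedRing
  let _ : NormedAlgebra ℝ (Matrix (Fin n) (Fin n) ℝ) := Matrix.linftyOpNormedAlgebra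
  let L : Matrix (Fin n) (Fin n) ℝ → Matrix (Fin n) (Fin n) ℝ →ₗ[ℝ] Matrix (Fin n) (Fin n) ℝ :=
    fun B => LinearMap.mulLeft ℝ A - LinearMap.mulRight ℝ B
  have hL : ∀ B X, L B X = A * X - X * B := fun _ _ => rfl
  obtain ⟨W, hW⟩ := (LinearMap.ker (L A)).exists_isCompl
  have hinj : LinearMap.ker ((L A).domRestrict W) = ⊥ := by
    rw [LinearMap.ker_eq_bot']
    rintro ⟨w, hw⟩ h
    have : w ∈ LinearMap.ker (L A) ⊓ W := ⟨h, hw⟩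
    rw [hW.inf_eq_bot] at this
    exact Subtype.ext this
  obtain ⟨K, hK, hanti⟩ := LinearMap.exists_antilipschitzWith _ hinj
  have hbound : ∀ w ∈ W, ‖w‖ ≤ K * ‖A * w - w * A‖ := fun w hw => by
    have := hanti.le_mul_dist ⟨w, hw⟩ 0
    rw [map_zero, dist_zero_right, dist_zero_right] at this
    exact this
  have hbound' : ∀ B, K * ‖B - A‖ < 1 / 2 → ∀ w ∈ W, ‖w‖ ≤ 2 * K * ‖L B w‖ := by
    intro B hB w hw
    have h1 := hbound w hw
    have h2 : A * w - w * A = L B w + w * (B - A) := by rw [hL]; noncomm_ring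
    have h3 : ‖A * w - w * A‖ ≤ ‖L B w‖ + ‖w‖ * ‖B - A‖ := by
      rw [h2]
      exact (norm_add_le _ _).trans (by gcongr; exact norm_mul_le _ _)
    have h4 : (K : ℝ) * ‖A * w - w * A‖ ≤ K * (‖L B w‖ + ‖w‖ * ‖B - A‖) := by gcongr
    nlinarith [norm_nonneg w]
  obtain ⟨δ, hδ, hδU⟩ := Metric.mem_nhds_iff.1 hU
  have hlim : Filter.Tendsto (fun B : Matrix (Fin n) (Fin n) ℝ => (K : ℝ) * ‖B - A‖)
      (𝓝 A) (𝓝 0) := by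
    have : Continuous fun B : Matrix (Fin n) (Fin n) ℝ => (K : ℝ) * ‖B - A‖ := by fun_prop
    simpa using this.tendsto A
  filter_upwards [hlim.eventually_lt_const (show (0 : ℝ) < 1 / 2 by norm_num),
    hlim.eventually_lt_const (show (0 : ℝ) < δ / 2 by positivity)] with B hB hBδ
  rintro ⟨G, H, hGH, hHG, hBG⟩
  have hdisj : Disjoint (LinearMap.ker (L B)) W := by
    rw [Submodule.disjoint_def]
    intro w hw hwW
    have := hbound' B hB w hwW
    rw [LinearMap.mem_ker.1 hw, norm_zero, mul_zero] at this
    exact norm_le_zero_iff.1 this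
  have hrank : Module.finrank ℝ (LinearMap.ker (L A)) ≤ Module.finrank ℝ (LinearMap.ker (L B)) := by
    have hmaps : ∀ X ∈ LinearMap.ker (L A), LinearMap.mulRight ℝ G X ∈ LinearMap.ker (L B) := by
      intro X hX
      rw [LinearMap.mem_ker, hL, sub_eq_zero] at hX
      rw [LinearMap.mem_ker, hL, sub_eq_zero, LinearMap.mulRight_apply, hBG]
      calc A * (X * G) = A * X * G := by noncomm_ring
        _ = X * (G * H) * A * G := by rw [hX, hGH, mul_one]
        _ = X * G * (H * A * G) := by noncomm_ring
    refine LinearMap.finrank_le_finrank_of_injective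
      (f := (LinearMap.mulRight ℝ G).restrict hmaps) ?_
    intro X Y hXY
    have h : (X : Matrix (Fin n) (Fin n) ℝ) * G = Y * G := congrArg Subtype.val hXY
    apply Subtype.ext
    calc (X : Matrix (Fin n) (Fin n) ℝ) = X * G * H := by rw [mul_assoc, hGH, mul_one]
      _ = Y := by rw [h, mul_assoc, hGH, mul_one]
  have htop : LinearMap.ker (L B) ⊔ W = ⊤ := by
    apply Submodule.eq_top_of_disjoint _ _ _ hdisj
    rw [← Submodule.finrank_add_eq_of_isCompl hW]
    gcongr
  obtain ⟨X, hX, w, hw, hXw⟩ := Submodule.mem_sup.1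
    (htop ▸ Submodule.mem_top : (1 : Matrix (Fin n) (Fin n) ℝ) ∈ LinearMap.ker (L B) ⊔ W)
  refine ⟨X, hδU ?_, sub_eq_zero.1 hX⟩
  have hLw : L B w = A - B := by
    have h := congrArg (L B) hXw
    rw [map_add, LinearMap.mem_ker.1 hX, zero_add, hL B 1, mul_one, one_mul] at h
    exact h
  have h := hbound' B hB w hw
  rw [hLw, norm_sub_rev] at h
  rw [Metric.mem_ball, dist_eq_norm, ← hXw, sub_add_cancel_left, norm_neg]
  linarith

/-- An elementary strong shift equivalence over `ℝ₊` between positive matrices of the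
same size. -/
def PosESSE {n : ℕ} (X Y : Matrix (Fin n) (Fin n) ℝ) : Prop :=
  PosEntries X ∧ PosEntries Y ∧
    ∃ R S : Matrix (Fin n) (Fin n) ℝ,
      (∀ i j, 0 ≤ R i j) ∧ (∀ i j, 0 ≤ S i j) ∧ X = R * S ∧ Y = S * R

lemma PosESSE.symm {n : ℕ} {X Y : Matrix (Fin n) (Fin n) ℝ} (h : PosESSE X Y) : PosESSE Y X := by
  obtain ⟨hX, hY, R, S, hR, hS, h1, h2⟩ := h
  exact ⟨hY, hX, S, R, hS, hR, h2, h1⟩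

lemma PosESSE.of_conj {n : ℕ} {A Z : Matrix (Fin n) (Fin n) ℝ} (hA : PosEntries A)
    (hZ : PosEntries Z) (hdet : Z.det ≠ 0) (hZA : PosEntries (Z⁻¹ * A))
    (hconj : PosEntries (Z⁻¹ * A * Z)) : PosESSE A (Z⁻¹ * A * Z) :=
  ⟨hA, hconj, Z, Z⁻¹ * A, fun i j => (hZ i j).le, fun i j => (hZA i j).le,
    (Matrix.mul_nonsing_inv_cancel_left Z A hdet.isUnit).symm, rfl⟩

/-- A positive matrix `A` admits an invertible positive `W` such that `W⁻¹ * A` and the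
conjugate `W⁻¹ * A * W` are positive. -/
lemma exists_pos_conjugator {n : ℕ} {A : Matrix (Fin n) (Fin n) ℝ} (hA : PosEntries A) :
    ∃ W : Matrix (Fin n) (Fin n) ℝ, PosEntries W ∧ W.det ≠ 0 ∧ PosEntries (W⁻¹ * A) ∧
      PosEntries (W⁻¹ * A * W) := by
  let F : ℝ → Matrix (Fin n) (Fin n) ℝ := fun ε => 1 + ε • Matrix.of fun _ _ => 1
  have hF : ContinuousAt F 0 := by fun_prop
  have hF0 : F 0 = 1 := by simp [F]
  have hdet0 : (F 0).det ≠ 0 := by simp [hF0]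
  have hdet : ∀ᶠ ε in 𝓝 (0 : ℝ), (F ε).det ≠ 0 :=
    ((continuous_id.matrix_det).continuousAt.comp hF).eventually_ne hdet0
  have hinv : ContinuousAt (fun ε => (F ε)⁻¹ * A) 0 :=
    ((continuousAt_inv_of_det_ne_zero hdet0).comp hF).mul continuousAt_const
  have h1 : ∀ᶠ ε in 𝓝 (0 : ℝ), PosEntries ((F ε)⁻¹ * A) :=
    hinv (isOpen_setOf_posEntries.mem_nhds (by simpa [hF0] using hA))
  have h2 : ∀ᶠ ε in 𝓝 (0 : ℝ), PosEntries ((F ε)⁻¹ * A * F ε) :=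
    (hinv.mul hF) (isOpen_setOf_posEntries.mem_nhds (by simpa [hF0] using hA))
  obtain ⟨ε, ⟨hd, h1, h2⟩, hε⟩ :=
    (((hdet.and (h1.and h2)).filter_mono nhdsWithin_le_nhds).and
      (self_mem_nhdsWithin : Set.Ioi (0 : ℝ) ∈ 𝓝[>] 0)).exists
  refine ⟨F ε, fun i j => ?_, hd, h1, h2⟩
  have hε' : 0 < ε := hε
  by_cases hij : i = j
  · subst hij
    simp only [F, Matrix.add_apply, Matrix.one_apply_eq, Matrix.smul_apply, Matrix.of_apply,
      smul_eq_mul]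
    positivity
  · simpa [F, hij] using hε'

/-- Positive matrices conjugate to a positive matrix `A` and close to it are strong shift
equivalent to `A` through positive matrices. -/
lemma eventually_reflTransGen_posESSE {n : ℕ} {A : Matrix (Fin n) (Fin n) ℝ}
    (hA : PosEntries A) :
    ∀ᶠ B in 𝓝 A, (∃ G H : Matrix (Fin n) (Fin n) ℝ, G * H = 1 ∧ H * G = 1 ∧ B = H * A * G) →
      Relation.ReflTransGen PosESSE A B := by
  obtain ⟨W, hW, hWdet, hWA, hWAW⟩ := exists_pos_conjugator hA
  have hZ : ContinuousAt (fun X : Matrix (Fin n) (Fin n) ℝ => X * W) 1 := by fun_prop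
  have hdet : ∀ᶠ X in 𝓝 (1 : Matrix (Fin n) (Fin n) ℝ), (X * W).det ≠ 0 :=
    ((continuous_id.matrix_det).continuousAt.comp hZ).eventually_ne (by simpa using hWdet)
  have hinv : ContinuousAt (fun X : Matrix (Fin n) (Fin n) ℝ => (X * W)⁻¹ * A) 1 :=
    ((continuousAt_inv_of_det_ne_zero (by simpa using hWdet)).comp hZ).mul continuousAt_const
  have hpos : ∀ᶠ X in 𝓝 (1 : Matrix (Fin n) (Fin n) ℝ), PosEntries (X * W) :=
    hZ (isOpen_setOf_posEntries.mem_nhds (by simpa using hW))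
  have h1 : ∀ᶠ X in 𝓝 (1 : Matrix (Fin n) (Fin n) ℝ), PosEntries ((X * W)⁻¹ * A) :=
    hinv (isOpen_setOf_posEntries.mem_nhds (by simpa using hWA))
  have h2 : ∀ᶠ X in 𝓝 (1 : Matrix (Fin n) (Fin n) ℝ), PosEntries ((X * W)⁻¹ * A * (X * W)) :=
    (hinv.mul hZ) (isOpen_setOf_posEntries.mem_nhds (by simpa using hWAW))
  have hB : ∀ᶠ B in 𝓝 A, PosEntries (W⁻¹ * B) :=
    (show ContinuousAt (fun B => W⁻¹ * B) A by fun_prop)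
      (isOpen_setOf_posEntries.mem_nhds hWA)
  filter_upwards [eventually_exists_intertwiner A (hdet.and (hpos.and (h1.and h2))), hB,
    isOpen_setOf_posEntries.mem_nhds hA] with B hX hWB hBpos hconj
  obtain ⟨X, ⟨hd, hp, h1, h2⟩, hAX⟩ := hX hconj
  have hC : (X * W)⁻¹ * A * (X * W) = W⁻¹ * B * W := by
    calc (X * W)⁻¹ * A * (X * W) = (X * W)⁻¹ * (A * X) * W := by simp only [mul_assoc]
      _ = (X * W)⁻¹ * (X * (W * (W⁻¹ * B))) * W := by
        rw [hAX, Matrix.mul_nonsing_inv_cancel_left W B hWdet.isUnit]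
      _ = W⁻¹ * B * W := by
        rw [← mul_assoc X, Matrix.nonsing_inv_mul_cancel_left _ _ hd.isUnit]
  have hAC := PosESSE.of_conj hA hp hd h1 h2
  have hBC := PosESSE.of_conj hBpos hW hWdet hWB (hC ▸ h2)
  rw [hC] at hAC
  exact (Relation.ReflTransGen.single hAC).tail hBC.symm

/-- Path Theorem, part (1): matrices on a continuous path of positive conjugate `n × n`
real matrices are strong shift equivalent over `ℝ₊` through positive matrices of
size `n`. -/
theorem path_theorem (n : ℕ) (A : ℝ → Matrix (Fin n) (Fin n) ℝ)
    (hcont : ContinuousOn A (Set.Icc 0 1))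
    (hpos : ∀ t ∈ Set.Icc (0 : ℝ) 1, PosEntries (A t))
    (hconj : ∀ t ∈ Set.Icc (0 : ℝ) 1, ∃ G Ginv : Matrix (Fin n) (Fin n) ℝ,
      G * Ginv = 1 ∧ Ginv * G = 1 ∧ A t = Ginv * A 0 * G) :
    Relation.ReflTransGen
      (fun X Y : Matrix (Fin n) (Fin n) ℝ =>
        PosEntries X ∧ PosEntries Y ∧
        ∃ R S : Matrix (Fin n) (Fin n) ℝ,
          (∀ i j, 0 ≤ R i j) ∧ (∀ i j, 0 ≤ S i j) ∧ X = R * S ∧ Y = S * R)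
      (A 0) (A 1) := by
  change Relation.ReflTransGen PosESSE (A 0) (A 1)
  have : Std.Symm (PosESSE (n := n)) := ⟨fun _ _ => PosESSE.symm⟩
  refine isPreconnected_Icc.induction₂ (s := Set.Icc (0 : ℝ) 1)
    (fun s t => Relation.ReflTransGen PosESSE (A s) (A t)) ?_
    (fun _ _ _ _ _ _ => Relation.ReflTransGen.trans) (fun _ _ _ _ => symm_of (Relation.ReflTransGen PosESSE))
    (by simp) (by simp)
  intro s hs
  filter_upwards [(hcont s hs).eventually (eventually_reflTransGen_posESSE (hpos s hs)),
    self_mem_nhdsWithin] with t h ht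
  obtain ⟨G, H, hGH, hHG, hG⟩ := hconj s hs
  obtain ⟨G', H', hGH', hHG', hG'⟩ := hconj t ht
  refine h ⟨H * G', H' * G, ?_, ?_, ?_⟩
  · rw [mul_assoc, ← mul_assoc G', hGH', one_mul, hHG]
  · rw [mul_assoc, ← mul_assoc G, hGH, one_mul, hHG']
  · calc A t = H' * (G * H) * A 0 * (G * H) * G' := by rw [hGH, mul_one, mul_one, hG']
      _ = H' * G * A s * (H * G') := by rw [hG]; simp only [mul_assoc]
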